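/- Let d_A, d_B, d_E be positive natural numbers and V an isometry from ℂ^{d_A} to ℂ^{d_B} ⊗ ℂ^{d_E}, with associated channel Φ(ρ) = Tr_E(V ρ Vᴴ). Define the χ-function of Φ by C̄(Φ, ρ) = sup { χ(Φ(μ)) : μ a Borel probability measure on S_{d_A} with ρ̄(μ) = ρ }, where ρ̄(μ) = ∫ σ μ(dσ) and χ(Φ(μ)) = H(Φ(ρ̄(μ))) − ∫ H(Φ(σ)) μ(dσ). Then ρ ↦ C̄(Φ, ρ) is a continuous function on the set S_{d_A} of states on ℂ^{d_A}. -/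

import Mathlib

open MeasureTheory ComplexOrder Matrix

noncomputable section

instance matMS {m n : Type*} : MeasurableSpace (Matrix m n ℂ) :=
  inferInstanceAs (MeasurableSpace (m → n → ℂ))

instance matBS {m n : Type*} [Countable m] [Countable n] : BorelSpace (Matrix m n ℂ) :=
  inferInstanceAs (BorelSpace (m → n → ℂ))

/-- The set of quantum states (density matrices). -/
def stateSet (n : ℕ) : Set (Matrix (Fin n) (Fin n) ℂ) :=
  {ρ | ρ.PosSemidef ∧ ρ.trace = 1}

/-- Von Neumann entropy: sum of `negMulLog` over eigenvalues. -/
def vnEntropy {ι : Type*} [Fintype ι] [DecidableEq ι] (ρ : Matrix ι ι ℂ) : ℝ :=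
  if h : ρ.IsHermitian then ∑ i, Real.negMulLog (h.eigenvalues i) else 0

/-- Partial trace over the second (environment) factor. -/
def ptraceE {dB dE : ℕ} (M : Matrix (Fin dB × Fin dE) (Fin dB × Fin dE) ℂ) :
    Matrix (Fin dB) (Fin dB) ℂ :=
  Matrix.of fun b b' => ∑ e, M (b, e) (b', e)

/-- Partial trace over the first factor. -/
def ptraceB {dB dE : ℕ} (M : Matrix (Fin dB × Fin dE) (Fin dB × Fin dE) ℂ) :
    Matrix (Fin dE) (Fin dE) ℂ :=
  Matrix.of fun e e' => ∑ b, M (b, e) (b, e')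

/-- Quantum mutual information I(B:E) of a bipartite state. -/
def qmi {dB dE : ℕ} (ω : Matrix (Fin dB × Fin dE) (Fin dB × Fin dE) ℂ) : ℝ :=
  vnEntropy (ptraceE ω) + vnEntropy (ptraceB ω) - vnEntropy ω

/-- The channel `ρ ↦ Tr_E (V ρ V†)` associated with a Stinespring isometry `V`. -/
def chanPhi {dA dB dE : ℕ} (V : Matrix (Fin dB × Fin dE) (Fin dA) ℂ)
    (ρ : Matrix (Fin dA) (Fin dA) ℂ) : Matrix (Fin dB) (Fin dB) ℂ :=
  ptraceE (V * ρ * Vᴴ)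

/-- The complementary channel `ρ ↦ Tr_B (V ρ V†)`. -/
def chanPhiHat {dA dB dE : ℕ} (V : Matrix (Fin dB × Fin dE) (Fin dA) ℂ)
    (ρ : Matrix (Fin dA) (Fin dA) ℂ) : Matrix (Fin dE) (Fin dE) ℂ :=
  ptraceB (V * ρ * Vᴴ)

/-- Barycenter (average state) of a generalized ensemble. -/
def barycenter {n : ℕ} (μ : ProbabilityMeasure (stateSet n)) :
    Matrix (Fin n) (Fin n) ℂ :=
  Matrix.of fun i j => ∫ ρ : stateSet n, ρ.1 i j ∂(μ : Measure (stateSet n))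

/-- Output χ-quantity of a generalized ensemble under a map `Φ`. -/
def gChiOut {n d : ℕ} (Φ : Matrix (Fin n) (Fin n) ℂ → Matrix (Fin d) (Fin d) ℂ)
    (μ : ProbabilityMeasure (stateSet n)) : ℝ :=
  vnEntropy (Φ (barycenter μ)) -
    ∫ ρ : stateSet n, vnEntropy (Φ ρ.1) ∂(μ : Measure (stateSet n))

/-- χ-quantity of a generalized ensemble. -/
def gChi {n : ℕ} (μ : ProbabilityMeasure (stateSet n)) : ℝ :=
  vnEntropy (barycenter μ) -
    ∫ ρ : stateSet n, vnEntropy ρ.1 ∂(μ : Measure (stateSet n))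

/-- Holevo χ-quantity of a finite ensemble. -/
def finChi {d m : ℕ} (π : Fin m → ℝ) (σ : Fin m → Matrix (Fin d) (Fin d) ℂ) : ℝ :=
  vnEntropy (∑ i, π i • σ i) - ∑ i, π i * vnEntropy (σ i)

/-- The set of pure states (rank-one projections) viewed inside the state space. -/
def pureStates (n : ℕ) : Set (stateSet n) := {ρ | ρ.1 * ρ.1 = ρ.1}

end

open Filter Topology

section aux
open scoped Matrix.Norms.L2Operator

lemma state_herm {n : ℕ} {ρ : Matrix (Fin n) (Fin n) ℂ} (h : ρ ∈ stateSet n) : ρ.IsHermitian :=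
  h.1.isHermitian

lemma state_spectrum {n : ℕ} {ρ : Matrix (Fin n) (Fin n) ℂ} (h : ρ ∈ stateSet n) :
    spectrum ℝ ρ ⊆ Set.Icc 0 1 := by
  have hh := state_herm h
  have hsum : ∑ i, hh.eigenvalues i = 1 := by
    have := hh.trace_eq_sum_eigenvalues
    rw [h.2] at this
    simpa using congrArg Complex.re this.symm
  rw [hh.spectrum_real_eq_range_eigenvalues]
  rintro _ ⟨i, rfl⟩
  refine ⟨h.1.eigenvalues_nonneg i, ?_⟩
  rw [← hsum]
  exact Finset.single_le_sum (fun j _ => h.1.eigenvalues_nonneg j) (Finset.mem_univ i)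

lemma continuous_cfc_state {n : ℕ} (f : ℝ → ℝ) (hf : Continuous f) :
    Continuous (fun ρ : stateSet n => cfc f ρ.1) := by
  refine Continuous.cfc' (s := Set.Icc 0 1) isCompact_Icc f continuous_subtype_val
    (fun x => state_spectrum x.2) hf.continuousOn (fun x => (state_herm x.2).isSelfAdjoint)

lemma vnEntropy_eq {n : ℕ} {ρ : Matrix (Fin n) (Fin n) ℂ} (h : ρ.IsHermitian) :
    vnEntropy ρ = (cfc Real.negMulLog ρ).trace.re := by
  rw [h.cfc_eq, Matrix.IsHermitian.cfc, vnEntropy, dif_pos h]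
  rw [Unitary.conjStarAlgAut_apply, Matrix.trace_mul_cycle]
  simp [Matrix.trace]

lemma continuous_vnEntropy_state {n : ℕ} :
    Continuous (fun ρ : stateSet n => vnEntropy ρ.1) := by
  have : (fun ρ : stateSet n => vnEntropy ρ.1) =
      fun ρ : stateSet n => (cfc Real.negMulLog ρ.1).trace.re := by
    funext ρ
    exact vnEntropy_eq (state_herm ρ.2)
  rw [this]
  exact Complex.continuous_re.comp
    ((continuous_cfc_state _ Real.continuous_negMulLog).matrix_trace)

lemma isClosed_posSemidef (n : ℕ) :
    IsClosed {ρ : Matrix (Fin n) (Fin n) ℂ | ρ.PosSemidef} := by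
  simp only [Matrix.posSemidef_iff_dotProduct_mulVec, Set.ofPred_and, Set.ofPred_forall]
  refine IsClosed.inter ?_ (isClosed_iInter fun x => ?_)
  · exact isClosed_eq (continuous_id.matrix_conjTranspose) continuous_id
  · exact isClosed_le continuous_const (by fun_prop)

lemma norm_state_le {n : ℕ} {ρ : Matrix (Fin n) (Fin n) ℂ} (h : ρ ∈ stateSet n) : ‖ρ‖ ≤ 1 := by
  rw [← cfc_id ℝ ρ (state_herm h).isSelfAdjoint]
  refine norm_cfc_le zero_le_one fun x hx => ?_
  have := state_spectrum h hx
  rw [id, Real.norm_of_nonneg this.1]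
  exact this.2

instance compact_state (n : ℕ) : CompactSpace (stateSet n) := by
  rw [← isCompact_iff_compactSpace]
  refine Metric.isCompact_of_isClosed_isBounded ?_ ?_
  · exact (isClosed_posSemidef n).inter
      (isClosed_eq (continuous_id.matrix_trace) continuous_const)
  · exact (Metric.isBounded_closedBall (x := 0) (r := 1)).subset fun ρ h => by
      simpa using norm_state_le h

lemma ptraceE_posSemidef {dB dE : ℕ} {M : Matrix (Fin dB × Fin dE) (Fin dB × Fin dE) ℂ}
    (h : M.PosSemidef) : (ptraceE M).PosSemidef := by
  have : ptraceE M = ∑ e, M.submatrix (fun b => (b, e)) (fun b => (b, e)) := by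
    ext i j
    simp [ptraceE, Matrix.sum_apply]
  rw [this]
  exact Matrix.posSemidef_sum _ fun e _ => h.submatrix _

lemma chanPhi_mem {dA dB dE : ℕ} (V : Matrix (Fin dB × Fin dE) (Fin dA) ℂ) (hV : Vᴴ * V = 1)
    {ρ : Matrix (Fin dA) (Fin dA) ℂ} (h : ρ ∈ stateSet dA) : chanPhi V ρ ∈ stateSet dB := by
  refine ⟨ptraceE_posSemidef (h.1.mul_mul_conjTranspose_same V), ?_⟩
  have : (chanPhi V ρ).trace = (V * ρ * Vᴴ).trace := by
    simp [chanPhi, ptraceE, Matrix.trace, Fintype.sum_prod_type]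
  rw [this, Matrix.trace_mul_cycle, hV, one_mul, h.2]

lemma continuous_chan_entropy {dA dB dE : ℕ} (V : Matrix (Fin dB × Fin dE) (Fin dA) ℂ)
    (hV : Vᴴ * V = 1) : Continuous (fun ρ : stateSet dA => vnEntropy (chanPhi V ρ.1)) := by
  have h1 : Continuous (fun ρ : stateSet dA =>
      (⟨chanPhi V ρ.1, chanPhi_mem V hV ρ.2⟩ : stateSet dB)) := by
    refine Continuous.subtype_mk ?_ _
    refine continuous_matrix fun i j => ?_
    simp only [chanPhi, ptraceE, Matrix.of_apply]
    refine continuous_finsetSum _ fun e _ => ?_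
    refine Continuous.matrix_elem ?_ _ _
    fun_prop
  exact continuous_vnEntropy_state.comp h1

end aux

section aux2

lemma int_cont {n : ℕ} {E : Type*} [NormedAddCommGroup E] [SecondCountableTopology E]
    (μ : Measure (stateSet n)) [IsFiniteMeasure μ] {g : stateSet n → E}
    (hg : Continuous g) : Integrable g μ := by
  have : SecondCountableTopology (Matrix (Fin n) (Fin n) ℂ) :=
    inferInstanceAs (SecondCountableTopology (Fin n → Fin n → ℂ))
  obtain ⟨C, hC⟩ := (isCompact_univ.image hg).isBounded.exists_norm_le
  exact Integrable.of_bound hg.aestronglyMeasurable C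
    (Eventually.of_forall fun x => hC _ ⟨x, Set.mem_univ _, rfl⟩)

lemma continuous_entry {n : ℕ} (i j : Fin n) : Continuous fun σ : stateSet n => σ.1 i j :=
  continuous_subtype_val.matrix_elem i j

lemma integral_linear {n : ℕ} (μ : ProbabilityMeasure (stateSet n))
    (L : Matrix (Fin n) (Fin n) ℂ →ₗ[ℂ] ℂ) :
    ∫ σ : stateSet n, L σ.1 ∂(μ : Measure (stateSet n)) = L (barycenter μ) := by
  have key : ∀ M : Matrix (Fin n) (Fin n) ℂ, L M = ∑ i, ∑ j, M i j * L (Matrix.single i j 1) := by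
    intro M
    conv_lhs => rw [Matrix.matrix_eq_sum_single M]
    simp only [map_sum]
    refine Finset.sum_congr rfl fun i _ => Finset.sum_congr rfl fun j _ => ?_
    rw [← smul_eq_mul, ← map_smul, Matrix.smul_single, smul_eq_mul, mul_one]
  rw [key (barycenter μ)]
  simp_rw [fun σ : stateSet n => key σ.1]
  rw [integral_finsetSum _ fun i _ => integrable_finsetSum _ fun j _ =>
    (int_cont _ (continuous_entry i j)).mul_const _]
  refine Finset.sum_congr rfl fun i _ => ?_
  rw [integral_finsetSum _ fun j _ => (int_cont _ (continuous_entry i j)).mul_const _]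
  refine Finset.sum_congr rfl fun j _ => ?_
  rw [integral_mul_const]
  rfl

lemma smul_state_mem {n : ℕ} {M : Matrix (Fin n) (Fin n) ℂ} (h : M.PosSemidef)
    (ht : M.trace ≠ 0) : (M.trace)⁻¹ • M ∈ stateSet n := by
  refine ⟨h.smul ?_, ?_⟩
  · have := h.trace_nonneg
    exact inv_nonneg_of_nonneg this
  · rw [Matrix.trace_smul, smul_eq_mul, inv_mul_cancel₀ ht]

open Classical in
/-- Normalization of a positive semidefinite matrix. -/
noncomputable def nrm {n : ℕ} (τ : stateSet n) (M : Matrix (Fin n) (Fin n) ℂ) : stateSet n :=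
  if h : M.PosSemidef ∧ M.trace ≠ 0 then ⟨(M.trace)⁻¹ • M, smul_state_mem h.1 h.2⟩ else τ

lemma trace_re_eq {n : ℕ} {M : Matrix (Fin n) (Fin n) ℂ} (h : M.PosSemidef) :
    (M.trace.re : ℂ) = M.trace := by
  have := (Complex.nonneg_iff.1 h.trace_nonneg).2
  apply Complex.ext <;> simp [this]

lemma trace_re_nonneg {n : ℕ} {M : Matrix (Fin n) (Fin n) ℂ} (h : M.PosSemidef) :
    0 ≤ M.trace.re := (Complex.nonneg_iff.1 h.trace_nonneg).1

lemma trace_smul_nrm {n : ℕ} (τ : stateSet n) {M : Matrix (Fin n) (Fin n) ℂ}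
    (h : M.PosSemidef) : M.trace • (nrm τ M).1 = M := by
  by_cases ht : M.trace = 0
  · rw [ht, zero_smul, h.trace_eq_zero_iff.1 ht]
  · rw [nrm, dif_pos ⟨h, ht⟩]
    simp [smul_smul, ht]

lemma nrm_state {n : ℕ} (τ ρ : stateSet n) : nrm τ ρ.1 = ρ := by
  apply Subtype.ext
  have := trace_smul_nrm τ ρ.2.1
  rwa [ρ.2.2, one_smul] at this

/-- Homogeneous extension. -/
noncomputable def hom {n : ℕ} (f : stateSet n → ℝ) (τ : stateSet n)
    (M : Matrix (Fin n) (Fin n) ℂ) : ℝ := M.trace.re * f (nrm τ M)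

lemma continuous_hom {n : ℕ} {f : stateSet n → ℝ} (hf : Continuous f) (τ : stateSet n) :
    Continuous fun M : {M : Matrix (Fin n) (Fin n) ℂ // M.PosSemidef} => hom f τ M.1 := by
  have htr : Continuous fun M : {M : Matrix (Fin n) (Fin n) ℂ // M.PosSemidef} => M.1.trace :=
    continuous_subtype_val.matrix_trace
  rw [continuous_iff_continuousAt]
  intro M
  by_cases ht : M.1.trace = 0
  · obtain ⟨C, hC⟩ := (isCompact_univ.image hf).isBounded.exists_norm_le
    have h0 : hom f τ M.1 = 0 := by simp [hom, ht]
    rw [ContinuousAt, h0]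
    refine squeeze_zero_norm (a := fun M : {M : Matrix (Fin n) (Fin n) ℂ // M.PosSemidef} =>
      ‖M.1.trace.re‖ * C) (fun N => ?_) ?_
    · rw [hom, norm_mul]
      exact mul_le_mul_of_nonneg_left (hC _ ⟨_, Set.mem_univ _, rfl⟩) (norm_nonneg _)
    · have : Continuous fun M : {M : Matrix (Fin n) (Fin n) ℂ // M.PosSemidef} =>
        ‖M.1.trace.re‖ * C := by fun_prop
      have h := this.tendsto M
      simpa [ht] using h
  · have hev : ∀ᶠ N : {M : Matrix (Fin n) (Fin n) ℂ // M.PosSemidef} in 𝓝 M, N.1.trace ≠ 0 :=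
      htr.continuousAt.eventually_ne ht
    refine ContinuousAt.mul (Complex.continuous_re.comp htr).continuousAt ?_
    refine hf.continuousAt.comp ?_
    rw [Topology.IsInducing.subtypeVal.continuousAt_iff]
    have h2 : ContinuousAt (fun N : {M : Matrix (Fin n) (Fin n) ℂ // M.PosSemidef} =>
        (N.1.trace)⁻¹ • N.1) M :=
      (htr.continuousAt.inv₀ ht).smul continuous_subtype_val.continuousAt
    refine h2.congr ?_
    filter_upwards [hev] with N hN
    simp [nrm, N.2, hN]

lemma measurable_nrm {n : ℕ} (τ : stateSet n) :
    Measurable fun M : {M : Matrix (Fin n) (Fin n) ℂ // M.PosSemidef} => nrm τ M.1 := by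
  classical
  have : (fun M : {M : Matrix (Fin n) (Fin n) ℂ // M.PosSemidef} => (nrm τ M.1).1) =
      fun M => if M.1.trace = 0 then τ.1 else (M.1.trace)⁻¹ • M.1 := by
    funext M
    by_cases h : M.1.trace = 0 <;> simp [nrm, h, M.2]
  have hm : Measurable fun M : {M : Matrix (Fin n) (Fin n) ℂ // M.PosSemidef} => M.1.trace :=
    (continuous_subtype_val.matrix_trace).measurable
  have h2 : Measurable fun M : {M : Matrix (Fin n) (Fin n) ℂ // M.PosSemidef} =>
      (nrm τ M.1).1 := by
    rw [this]
    refine Measurable.ite (hm (measurableSet_singleton 0)) measurable_const ?_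
    refine measurable_pi_iff.2 fun i => measurable_pi_iff.2 fun j => ?_
    have h3 : Measurable fun M : {M : Matrix (Fin n) (Fin n) ℂ // M.PosSemidef} => M.1 i j :=
      (continuous_subtype_val.matrix_elem i j).measurable
    exact hm.inv.mul h3
  exact measurable_comap_iff.2 h2

lemma conj_psd {n : ℕ} (A : Matrix (Fin n) (Fin n) ℂ) (σ : stateSet n) :
    (A * σ.1 * Aᴴ).PosSemidef := σ.2.1.mul_mul_conjTranspose_same A

lemma measurable_nrm_conj {n : ℕ} (τ : stateSet n) (A : Matrix (Fin n) (Fin n) ℂ) :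
    Measurable fun σ : stateSet n => nrm τ (A * σ.1 * Aᴴ) := by
  have h : Continuous fun σ : stateSet n =>
      (⟨A * σ.1 * Aᴴ, conj_psd A σ⟩ : {M : Matrix (Fin n) (Fin n) ℂ // M.PosSemidef}) :=
    Continuous.subtype_mk (by fun_prop) _
  exact (measurable_nrm τ).comp h.measurable

/-- Transported ensemble. -/
noncomputable def transp {n : ℕ} (μ : Measure (stateSet n)) (τ : stateSet n)
    (A R : Matrix (Fin n) (Fin n) ℂ) : Measure (stateSet n) :=
  (μ.withDensity (fun σ => ((A * σ.1 * Aᴴ).trace.re.toNNReal : ENNReal))).map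
    (fun σ => nrm τ (A * σ.1 * Aᴴ)) +
  (R.trace.re.toNNReal : ENNReal) • Measure.dirac (nrm τ R)

lemma cont_w {n : ℕ} (A : Matrix (Fin n) (Fin n) ℂ) :
    Continuous fun σ : stateSet n => (A * σ.1 * Aᴴ).trace.re :=
  Complex.continuous_re.comp (Continuous.matrix_trace (by fun_prop))

lemma transp_finite {n : ℕ} (μ : ProbabilityMeasure (stateSet n)) (τ : stateSet n)
    (A R : Matrix (Fin n) (Fin n) ℂ) : IsFiniteMeasure (transp (μ : Measure (stateSet n)) τ A R) := by
  have : IsFiniteMeasure ((μ : Measure (stateSet n)).withDensity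
      (fun σ => ((A * σ.1 * Aᴴ).trace.re.toNNReal : ENNReal))) :=
    isFiniteMeasure_withDensity_ofReal (int_cont _ (cont_w A)).2
  have h2 : IsFiniteMeasure ((R.trace.re.toNNReal : ENNReal) • Measure.dirac (nrm τ R)) :=
    Measure.smul_finite _ (by simp)
  unfold transp
  infer_instance

lemma integral_transp {n : ℕ} {E : Type*} [NormedAddCommGroup E] [NormedSpace ℝ E]
    [SecondCountableTopology E] [CompleteSpace E]
    (μ : ProbabilityMeasure (stateSet n)) (τ : stateSet n)
    (A : Matrix (Fin n) (Fin n) ℂ) {R : Matrix (Fin n) (Fin n) ℂ} (hR : R.PosSemidef)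
    {g : stateSet n → E} (hg : Continuous g) :
    ∫ σ, g σ ∂(transp (μ : Measure (stateSet n)) τ A R) =
      ∫ σ : stateSet n, (A * σ.1 * Aᴴ).trace.re • g (nrm τ (A * σ.1 * Aᴴ))
        ∂(μ : Measure (stateSet n)) + R.trace.re • g (nrm τ R) := by
  have hfin := transp_finite μ τ A R
  have hI := int_cont (transp (μ : Measure (stateSet n)) τ A R) hg
  have : SecondCountableTopology (Matrix (Fin n) (Fin n) ℂ) :=
    inferInstanceAs (SecondCountableTopology (Fin n → Fin n → ℂ))
  unfold transp at hI ⊢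
  rw [integrable_add_measure] at hI
  rw [integral_add_measure hI.1 hI.2]
  congr 1
  · rw [integral_map (measurable_nrm_conj τ A).aemeasurable hg.aestronglyMeasurable]
    rw [integral_withDensity_eq_integral_smul (cont_w A).measurable.real_toNNReal]
    refine integral_congr_ae (Eventually.of_forall fun σ => ?_)
    simp only [NNReal.smul_def, Real.coe_toNNReal _ (trace_re_nonneg (conj_psd A σ))]
  · rw [integral_smul_measure, integral_dirac]
    simp [trace_re_nonneg hR]

/-- The linear map `M ↦ A M A†`. -/
noncomputable def conjL {n : ℕ} (A : Matrix (Fin n) (Fin n) ℂ) :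
    Matrix (Fin n) (Fin n) ℂ →ₗ[ℂ] Matrix (Fin n) (Fin n) ℂ :=
  (LinearMap.mulRight ℂ Aᴴ).comp (LinearMap.mulLeft ℂ A)

lemma exists_transp {n : ℕ} (μ : ProbabilityMeasure (stateSet n)) (τ ρ' : stateSet n)
    (A R : Matrix (Fin n) (Fin n) ℂ) (hR : R.PosSemidef)
    (hsum : A * barycenter μ * Aᴴ + R = ρ'.1) :
    ∃ μ' : ProbabilityMeasure (stateSet n), barycenter μ' = ρ'.1 ∧
      ∀ f : stateSet n → ℝ, Continuous f → ∫ σ, f σ ∂(μ' : Measure (stateSet n)) =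
        ∫ σ : stateSet n, hom f τ (A * σ.1 * Aᴴ) ∂(μ : Measure (stateSet n)) + hom f τ R := by
  have hfin := transp_finite μ τ A R
  have htr : ∫ σ : stateSet n, (A * σ.1 * Aᴴ).trace ∂(μ : Measure (stateSet n)) =
      (A * barycenter μ * Aᴴ).trace :=
    integral_linear μ ((Matrix.traceLinearMap (Fin n) ℂ ℂ).comp (conjL A))
  have hprob : IsProbabilityMeasure (transp (μ : Measure (stateSet n)) τ A R) := by
    have h1 := integral_transp μ τ A hR (g := fun _ => (1 : ℂ)) continuous_const
    have h2 : ∫ σ : stateSet n, (A * σ.1 * Aᴴ).trace.re • (1 : ℂ) ∂(μ : Measure (stateSet n)) =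
        (A * barycenter μ * Aᴴ).trace := by
      rw [← htr]
      refine integral_congr_ae (Eventually.of_forall fun σ => ?_)
      simp [trace_re_eq (conj_psd A σ)]
    have h3 : R.trace.re • (1 : ℂ) = R.trace := by simp [trace_re_eq hR]
    rw [h2, h3, ← Matrix.trace_add, hsum, ρ'.2.2, integral_const] at h1
    have h4 : (transp (μ : Measure (stateSet n)) τ A R).real Set.univ = 1 := by
      simpa using congrArg Complex.re h1
    refine ⟨?_⟩
    rw [Measure.real, ENNReal.toReal_eq_one_iff] at h4
    exact h4
  refine ⟨⟨transp (μ : Measure (stateSet n)) τ A R, hprob⟩, ?_, ?_⟩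
  · ext i j
    change ∫ σ : stateSet n, σ.1 i j ∂(transp (μ : Measure (stateSet n)) τ A R) = _
    rw [integral_transp μ τ A hR (continuous_entry i j), ← hsum, Matrix.add_apply]
    have hent : ∀ M : Matrix (Fin n) (Fin n) ℂ, M.PosSemidef →
        M.trace.re • (nrm τ M).1 i j = M i j := by
      intro M hM
      rw [Complex.real_smul, trace_re_eq hM]
      conv_rhs => rw [← trace_smul_nrm τ hM]
      rfl
    rw [hent R hR]
    congr 1
    rw [show (A * barycenter μ * Aᴴ) i j = ((Matrix.entryLinearMap ℂ ℂ i j).comp (conjL A))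
      (barycenter μ) from rfl, ← integral_linear]
    refine integral_congr_ae (Eventually.of_forall fun σ => ?_)
    exact hent _ (conj_psd A σ)
  · intro f hf
    simp only [ProbabilityMeasure.coe_mk]
    rw [integral_transp μ τ A hR hf]
    rfl

end aux2

section aux3

lemma cont_on_spec {n : ℕ} {ρ : Matrix (Fin n) (Fin n) ℂ} (g : ℝ → ℝ) :
    ContinuousOn g (spectrum ℝ ρ) :=
  (Matrix.finite_real_spectrum (A := ρ)).continuousOn g

/-- Support indicator. -/
noncomputable def ef (x : ℝ) : ℝ := √x * (√x)⁻¹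

lemma ef_nonneg_mul {x : ℝ} (hx : 0 ≤ x) : x * ef x = x ∧ √x * ef x = √x ∧ ef x * ef x = ef x ∧
    (√x)⁻¹ * x * (√x)⁻¹ = ef x := by
  unfold ef
  by_cases h : √x = 0
  · have : x = 0 := (Real.sqrt_eq_zero hx).1 h
    simp [this]
  · have h2 : √x * √x = x := Real.mul_self_sqrt hx
    refine ⟨by field_simp, by field_simp, by field_simp, ?_⟩
    nth_rewrite 2 [← h2]
    field_simp

lemma cfc_herm {n : ℕ} (g : ℝ → ℝ) (ρ : Matrix (Fin n) (Fin n) ℂ) : (cfc g ρ)ᴴ = cfc g ρ :=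
  (cfc_predicate g ρ : IsSelfAdjoint (cfc g ρ))

lemma cfc_sqrt_sq {n : ℕ} (ρ : stateSet n) :
    cfc Real.sqrt ρ.1 * cfc Real.sqrt ρ.1 = ρ.1 := by
  have hsa : IsSelfAdjoint ρ.1 := (state_herm ρ.2).isSelfAdjoint
  rw [← cfc_mul _ _ _ (cont_on_spec _) (cont_on_spec _)]
  conv_rhs => rw [← cfc_id ℝ ρ.1 hsa]
  exact cfc_congr fun x hx => Real.mul_self_sqrt (state_spectrum ρ.2 hx).1

lemma supp_facts {n : ℕ} (ρ : stateSet n) :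
    cfc Real.sqrt ρ.1 * cfc (fun x => (√x)⁻¹) ρ.1 = cfc ef ρ.1 ∧
    cfc (fun x => (√x)⁻¹) ρ.1 * ρ.1 * cfc (fun x => (√x)⁻¹) ρ.1 = cfc ef ρ.1 ∧
    cfc ef ρ.1 * cfc ef ρ.1 = cfc ef ρ.1 ∧
    cfc Real.sqrt ρ.1 * cfc ef ρ.1 = cfc Real.sqrt ρ.1 ∧
    ρ.1 * cfc ef ρ.1 = ρ.1 := by
  have hsa : IsSelfAdjoint ρ.1 := (state_herm ρ.2).isSelfAdjoint
  have hpos : ∀ x ∈ spectrum ℝ ρ.1, 0 ≤ x := fun x hx => (state_spectrum ρ.2 hx).1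
  refine ⟨?_, ?_, ?_, ?_, ?_⟩
  · rw [← cfc_mul _ _ _ (cont_on_spec _) (cont_on_spec _)]
    rfl
  · have h : cfc (fun x => (√x)⁻¹) ρ.1 * cfc (id : ℝ → ℝ) ρ.1 * cfc (fun x => (√x)⁻¹) ρ.1 =
        cfc ef ρ.1 := by
      rw [← cfc_mul _ _ _ (cont_on_spec _) (cont_on_spec _),
        ← cfc_mul _ _ _ (cont_on_spec _) (cont_on_spec _)]
      exact cfc_congr fun x hx => (ef_nonneg_mul (hpos x hx)).2.2.2
    rwa [cfc_id ℝ ρ.1 hsa] at h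
  · rw [← cfc_mul _ _ _ (cont_on_spec _) (cont_on_spec _)]
    exact cfc_congr fun x hx => (ef_nonneg_mul (hpos x hx)).2.2.1
  · rw [← cfc_mul _ _ _ (cont_on_spec _) (cont_on_spec _)]
    exact cfc_congr fun x hx => (ef_nonneg_mul (hpos x hx)).2.1
  · have h : cfc (id : ℝ → ℝ) ρ.1 * cfc ef ρ.1 = cfc (id : ℝ → ℝ) ρ.1 := by
      rw [← cfc_mul _ _ _ (cont_on_spec _) (cont_on_spec _)]
      exact cfc_congr fun x hx => (ef_nonneg_mul (hpos x hx)).1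
    rwa [cfc_id ℝ ρ.1 hsa] at h

lemma proj_psd {n : ℕ} {Q : Matrix (Fin n) (Fin n) ℂ} (hQ : Q * Q = Q) (hh : Qᴴ = Q) :
    Q.PosSemidef := by
  have := Matrix.posSemidef_conjTranspose_mul_self Q
  rwa [hh, hQ] at this

/-- A measure with barycenter `ρ` is concentrated on states supported by the support of `ρ`. -/
lemma ae_supp {n : ℕ} (μ : ProbabilityMeasure (stateSet n)) (P : Matrix (Fin n) (Fin n) ℂ)
    (hP : P * P = P) (hh : Pᴴ = P) (hb : barycenter μ * P = barycenter μ) :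
    ∀ᵐ σ : stateSet n ∂(μ : Measure (stateSet n)), P * σ.1 * Pᴴ = σ.1 := by
  set Q := 1 - P with hQdef
  have hQ : Q * Q = Q := by
    rw [hQdef]; noncomm_ring; rw [hP]; abel
  have hQh : Qᴴ = Q := by simp [hQdef, hh]
  have hpsd : ∀ σ : stateSet n, (Q * σ.1 * Qᴴ).PosSemidef := fun σ => conj_psd Q σ
  have hint : ∫ σ : stateSet n, (Q * σ.1 * Qᴴ).trace ∂(μ : Measure (stateSet n)) = 0 := by
    have := integral_linear μ ((Matrix.traceLinearMap (Fin n) ℂ ℂ).comp (conjL Q))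
    refine this.trans ?_
    change (Q * barycenter μ * Qᴴ).trace = 0
    rw [hQh, mul_assoc, hQdef, mul_sub, mul_one, hb, sub_self, mul_zero, Matrix.trace_zero]
  have hre : ∫ σ : stateSet n, (Q * σ.1 * Qᴴ).trace.re ∂(μ : Measure (stateSet n)) = 0 := by
    have h2 : ∫ σ : stateSet n, (((Q * σ.1 * Qᴴ).trace.re : ℝ) : ℂ)
        ∂(μ : Measure (stateSet n)) = 0 := by
      rw [← hint]
      exact integral_congr_ae (Eventually.of_forall fun σ => trace_re_eq (hpsd σ))
    rw [integral_complex_ofReal] at h2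
    exact_mod_cast h2
  rw [integral_eq_zero_iff_of_nonneg (fun σ => trace_re_nonneg (hpsd σ))
    (int_cont _ (cont_w Q))] at hre
  filter_upwards [hre] with σ hσ
  have h0 : (Q * σ.1 * Qᴴ).trace = 0 := by
    rw [← trace_re_eq (hpsd σ), hσ]; simp
  have h1 : Q * σ.1 * Qᴴ = 0 := (hpsd σ).trace_eq_zero_iff.1 h0
  have h2 : σ.1 * Qᴴ = 0 := by
    obtain ⟨B, hB⟩ : ∃ B : Matrix (Fin n) (Fin n) ℂ, σ.1 = Bᴴ * B :=
      ⟨cfc Real.sqrt σ.1, by rw [cfc_herm, cfc_sqrt_sq]⟩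
    have h3 : (B * Qᴴ)ᴴ * (B * Qᴴ) = 0 := by
      rw [Matrix.conjTranspose_mul, Matrix.conjTranspose_conjTranspose, ← h1, hB]
      simp only [mul_assoc]
    rw [Matrix.conjTranspose_mul_self_eq_zero] at h3
    rw [hB, mul_assoc, h3, mul_zero]
  rw [hQh] at h2
  have h4 : Q * σ.1 = 0 := by
    have := congrArg Matrix.conjTranspose h2
    rwa [Matrix.conjTranspose_mul, hQh, (state_herm σ.2).eq, Matrix.conjTranspose_zero] at this
  have hPQ : P = 1 - Q := by simp [hQdef]
  rw [hh, hPQ, sub_mul, one_mul, h4, sub_zero, mul_sub, mul_one, h2, sub_zero]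

/-- Lower semicontinuity ingredient: transport of an ensemble to neighbouring barycenters. -/
lemma exists_transport_family {n : ℕ} {f : stateSet n → ℝ} (hf : Continuous f)
    (ρ₀ : stateSet n) (μ : ProbabilityMeasure (stateSet n)) (hμ : barycenter μ = ρ₀.1) :
    ∃ G : stateSet n → ℝ, Continuous G ∧ G ρ₀ = ∫ σ, f σ ∂(μ : Measure (stateSet n)) ∧
      ∀ ρ' : stateSet n, ∃ μ' : ProbabilityMeasure (stateSet n), barycenter μ' = ρ'.1 ∧
        ∫ σ, f σ ∂(μ' : Measure (stateSet n)) = G ρ' := by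
  have : SecondCountableTopology (Matrix (Fin n) (Fin n) ℂ) :=
    inferInstanceAs (SecondCountableTopology (Fin n → Fin n → ℂ))
  obtain ⟨hSK, hKK, hPP, hSP, hρP⟩ := supp_facts ρ₀
  set P := cfc ef ρ₀.1 with hPdef
  set K := cfc (fun x => (√x)⁻¹) ρ₀.1 with hKdef
  have hPh : Pᴴ = P := cfc_herm _ _
  have hKh : Kᴴ = K := cfc_herm _ _
  let S : stateSet n → Matrix (Fin n) (Fin n) ℂ := fun ρ => cfc Real.sqrt ρ.1
  have hS : Continuous S := continuous_cfc_state _ Real.continuous_sqrt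
  have hSh : ∀ ρ, (S ρ)ᴴ = S ρ := fun ρ => cfc_herm _ _
  have hQQ : (1 - P) * (1 - P) = 1 - P := by noncomm_ring; rw [hPP]; abel
  have hQh : (1 - P)ᴴ = 1 - P := by simp [hPh]
  have hR : ∀ ρ, (S ρ * (1 - P) * (S ρ)ᴴ).PosSemidef := fun ρ =>
    (proj_psd hQQ hQh).mul_mul_conjTranspose_same (S ρ)
  have hhom := continuous_hom hf ρ₀
  refine ⟨fun ρ' => ∫ σ : stateSet n, hom f ρ₀ ((S ρ' * K) * σ.1 * (S ρ' * K)ᴴ)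
    ∂(μ : Measure (stateSet n)) + hom f ρ₀ (S ρ' * (1 - P) * (S ρ')ᴴ), ?_, ?_, ?_⟩
  · refine Continuous.add ?_ ?_
    · have hc : Continuous (Function.uncurry fun (ρ' σ : stateSet n) =>
          hom f ρ₀ ((S ρ' * K) * σ.1 * (S ρ' * K)ᴴ)) := by
        have h : Continuous fun p : stateSet n × stateSet n =>
            (⟨(S p.1 * K) * p.2.1 * (S p.1 * K)ᴴ, conj_psd _ _⟩ :
              {M : Matrix (Fin n) (Fin n) ℂ // M.PosSemidef}) := by
          refine Continuous.subtype_mk ?_ _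
          have h1 : Continuous fun p : stateSet n × stateSet n => S p.1 * K :=
            (hS.comp continuous_fst).matrix_mul continuous_const
          exact (h1.matrix_mul (continuous_subtype_val.comp continuous_snd)).matrix_mul
            h1.matrix_conjTranspose
        exact hhom.comp h
      have := continuous_parametric_integral_of_continuous (μ := (μ : Measure (stateSet n)))
        hc isCompact_univ
      simpa using this
    · have h : Continuous fun ρ' : stateSet n => (⟨S ρ' * (1 - P) * (S ρ')ᴴ, hR ρ'⟩ :
              {M : Matrix (Fin n) (Fin n) ℂ // M.PosSemidef}) := by
        refine Continuous.subtype_mk ?_ _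
        exact (hS.matrix_mul continuous_const).matrix_mul hS.matrix_conjTranspose
      exact hhom.comp h
  · have h0 : S ρ₀ * (1 - P) * (S ρ₀)ᴴ = 0 := by
      change cfc Real.sqrt ρ₀.1 * (1 - P) * (cfc Real.sqrt ρ₀.1)ᴴ = 0
      rw [mul_sub, hSP, mul_one, sub_self, zero_mul]
    have h1 : S ρ₀ * K = P := hSK
    simp only [h0, h1]
    have h2 : hom f ρ₀ 0 = 0 := by simp [hom]
    rw [h2, add_zero]
    refine integral_congr_ae ?_
    filter_upwards [ae_supp μ P hPP hPh (by rw [hμ, hρP])] with σ hσ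
    rw [hσ, hom, nrm_state, σ.2.2]
    simp
  · intro ρ'
    obtain ⟨μ', h1, h2⟩ := exists_transp μ ρ₀ ρ' (S ρ' * K) (S ρ' * (1 - P) * (S ρ')ᴴ) (hR ρ') (by
      have h3 : S ρ' * K * ρ₀.1 * (S ρ' * K)ᴴ = S ρ' * P * S ρ' := by
        rw [Matrix.conjTranspose_mul, hKh, hSh, ← hKK]
        simp only [mul_assoc]
      rw [hμ, h3, hSh, ← add_mul, ← mul_add, add_sub_cancel, mul_one]
      exact cfc_sqrt_sq ρ')
    exact ⟨μ', h1, h2 f hf⟩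

lemma continuous_integral_pm {n : ℕ} {f : stateSet n → ℝ} (hf : Continuous f) :
    Continuous fun μ : ProbabilityMeasure (stateSet n) =>
      ∫ σ, f σ ∂(μ : Measure (stateSet n)) := by
  have := ProbabilityMeasure.continuous_integral_boundedContinuousFunction
    (BoundedContinuousFunction.mkOfCompact ⟨f, hf⟩)
  simpa using this

lemma continuous_barycenter {n : ℕ} : Continuous (barycenter (n := n)) := by
  refine continuous_matrix fun i j => ?_
  have h1 := continuous_integral_pm (Complex.continuous_re.comp (continuous_entry (n := n) i j))
  have h2 := continuous_integral_pm (Complex.continuous_im.comp (continuous_entry (n := n) i j))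
  have h : (fun μ : ProbabilityMeasure (stateSet n) => barycenter μ i j) =
      fun μ : ProbabilityMeasure (stateSet n) =>
      ((∫ σ : stateSet n, (σ.1 i j).re ∂(μ : Measure (stateSet n)) : ℝ) : ℂ) +
      ((∫ σ : stateSet n, (σ.1 i j).im ∂(μ : Measure (stateSet n)) : ℝ) : ℂ) * Complex.I := by
    funext μ
    exact (integral_re_add_im (𝕜 := ℂ)
      (int_cont (μ : Measure (stateSet n)) (continuous_entry i j))).symm
  rw [h]
  exact (Complex.continuous_ofReal.comp h1).add
    ((Complex.continuous_ofReal.comp h2).mul continuous_const)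

lemma barycenter_dirac {n : ℕ} (ρ : stateSet n) :
    barycenter ⟨Measure.dirac ρ, Measure.dirac.isProbabilityMeasure⟩ = ρ.1 := by
  have : SecondCountableTopology (Matrix (Fin n) (Fin n) ℂ) :=
    inferInstanceAs (SecondCountableTopology (Fin n → Fin n → ℂ))
  ext i j
  change ∫ σ : stateSet n, σ.1 i j ∂(Measure.dirac ρ) = _
  rw [integral_dirac]

theorem continuous_roof {n : ℕ} {f : stateSet n → ℝ} (hf : Continuous f) :
    Continuous fun ρ : stateSet n => sSup {x : ℝ | ∃ μ : ProbabilityMeasure (stateSet n),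
      barycenter μ = ρ.1 ∧ f ρ - ∫ σ, f σ ∂(μ : Measure (stateSet n)) = x} := by
  have hne : ∀ ρ : stateSet n, {x : ℝ | ∃ μ : ProbabilityMeasure (stateSet n),
      barycenter μ = ρ.1 ∧ f ρ - ∫ σ, f σ ∂(μ : Measure (stateSet n)) = x}.Nonempty :=
    fun ρ => ⟨_, _, barycenter_dirac ρ, rfl⟩
  have hbdd : ∀ ρ : stateSet n, BddAbove {x : ℝ | ∃ μ : ProbabilityMeasure (stateSet n),
      barycenter μ = ρ.1 ∧ f ρ - ∫ σ, f σ ∂(μ : Measure (stateSet n)) = x} := by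
    intro ρ
    obtain ⟨C, hC⟩ := isCompact_univ.bddAbove_image
      (f := fun μ : ProbabilityMeasure (stateSet n) =>
        f ρ - ∫ σ, f σ ∂(μ : Measure (stateSet n)))
      (continuous_const.sub (continuous_integral_pm hf)).continuousOn
    refine ⟨C, ?_⟩
    rintro _ ⟨μ, -, rfl⟩
    exact hC ⟨μ, Set.mem_univ _, rfl⟩
  rw [continuous_iff_continuousAt]
  intro ρ₀
  refine tendsto_order.2 ⟨fun c hc => ?_, fun c hc => ?_⟩
  · obtain ⟨_, ⟨μ, hμ, rfl⟩, hlt⟩ := exists_lt_of_lt_csSup (hne ρ₀) hc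
    obtain ⟨G, hG, hG0, hG'⟩ := exists_transport_family hf ρ₀ μ hμ
    rw [← hG0] at hlt
    filter_upwards [(hf.sub hG).continuousAt.eventually_const_lt hlt] with ρ' hρ'
    obtain ⟨μ', h1, h2⟩ := hG' ρ'
    refine lt_of_lt_of_le hρ' (le_csSup (hbdd ρ') ⟨μ', h1, ?_⟩)
    rw [h2, Pi.sub_apply]
  · obtain ⟨c', hc', hcc⟩ := exists_between hc
    have hZ : IsClosed {p : stateSet n × ProbabilityMeasure (stateSet n) |
        barycenter p.2 = p.1.1 ∧ c' ≤ f p.1 - ∫ σ, f σ ∂(p.2 : Measure (stateSet n))} := by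
      refine IsClosed.inter ?_ ?_
      · exact isClosed_eq (continuous_barycenter.comp continuous_snd)
          (continuous_subtype_val.comp continuous_fst)
      · exact isClosed_le continuous_const ((hf.comp continuous_fst).sub
          ((continuous_integral_pm hf).comp continuous_snd))
    have hc2 := isClosedMap_fst_of_compactSpace _ hZ
    have hmem : ρ₀ ∉ Prod.fst '' {p : stateSet n × ProbabilityMeasure (stateSet n) |
        barycenter p.2 = p.1.1 ∧ c' ≤ f p.1 - ∫ σ, f σ ∂(p.2 : Measure (stateSet n))} := by
      rintro ⟨⟨_, μ⟩, ⟨h1, h2⟩, rfl⟩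
      exact absurd (le_csSup (hbdd _) ⟨μ, h1, rfl⟩) (not_le.2 (hc'.trans_le h2))
    filter_upwards [hc2.isOpen_compl.mem_nhds hmem] with ρ' hρ'
    refine lt_of_le_of_lt (csSup_le (hne ρ') ?_) hcc
    rintro _ ⟨μ, h1, rfl⟩
    by_contra hlt
    exact hρ' ⟨(ρ', μ), ⟨h1, (not_le.1 hlt).le⟩, rfl⟩

end aux3

/-- The χ-function `ρ ↦ C̄(Φ, ρ) = sup { χ(Φ(μ)) : ρ̄(μ) = ρ }` is continuous on the
set of states. -/
theorem continuous_chi_function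
    (dA dB dE : ℕ) (hdA : 0 < dA) (hdB : 0 < dB) (hdE : 0 < dE)
    (V : Matrix (Fin dB × Fin dE) (Fin dA) ℂ) (hV : Vᴴ * V = 1) :
    Continuous (fun ρ : stateSet dA =>
      sSup {x : ℝ | ∃ μ : ProbabilityMeasure (stateSet dA),
        barycenter μ = ρ.1 ∧ gChiOut (chanPhi V) μ = x}) := by
  have h := continuous_roof (continuous_chan_entropy V hV)
  convert h using 3 with ρ
  ext x
  refine exists_congr fun μ => and_congr_right fun hμ => ?_
  rw [gChiOut, hμ]
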